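/- Suppose f: Ω → ℝ is continuous and h: Ω → [0,∞) satisfies |f(ω')| ≤ h(ω') for all ω' ∈ Ω. Let ω ∈ Ω' be averaging and assume sup_{n≥1} n^{-d} Σ_{x∈Λ_n} [h(τ_x(ω))]^α < ∞ for some α > 1. Then f ∈ L¹(P_ω) and the limit ℓ_ω(f) = lim_{n→∞} |Λ_n|^{-1} Σ_{x∈Λ_n} f(τ_x(ω)) exists and equals E_{P_ω}(f). -/

import Mathlib

open MeasureTheory Filter Topology Matrix
open scoped ENNReal NNReal

noncomputable section

namespace DetCond

/-- Vertices of `ℤ^d`. -/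
abbrev Vert (d : ℕ) := Fin d → ℤ

/-- Index of the (unordered) nearest-neighbour edge `(x, x + e i)` of `ℤ^d`;
the set of these indices is in natural bijection with `E(ℤ^d)` modulo orientation. -/
abbrev EdgeIx (d : ℕ) := Vert d × Fin d

/-- The space `Ω = (0,∞)^{E(ℤ^d)}` of (symmetric) conductance configurations, with
its product topology and product σ-algebra. -/
abbrev EnvSp (d : ℕ) := {ω : EdgeIx d → ℝ // ∀ e, 0 < ω e}

/-- The `i`-th coordinate unit vector of `ℤ^d`. -/
def unitv (d : ℕ) (i : Fin d) : Vert d := fun j => if j = i then 1 else 0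

/-- The translation `τ_x` acting on environments: `c_{τ_x ω}(y,z) = c_ω(y+x,z+x)`. -/
def shift (d : ℕ) (x : Vert d) (ω : EnvSp d) : EnvSp d :=
  ⟨fun e => ω.1 (e.1 + x, e.2), fun e => ω.2 (e.1 + x, e.2)⟩

/-- The conductance `c_ω(x,y)`; it vanishes when `x,y` are not nearest neighbours
and is symmetric in `x,y` by construction. -/
def cnd (d : ℕ) (ω : EnvSp d) (x y : Vert d) : ℝ :=
  ∑ i, ((if y = x + unitv d i then ω.1 (x, i) else 0) +
        (if x = y + unitv d i then ω.1 (y, i) else 0))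

/-- `π_ω(x) = Σ_{z : (x,z) ∈ E(ℤ^d)} c_ω(x,z)`. -/
def piOf (d : ℕ) (ω : EnvSp d) (x : Vert d) : ℝ :=
  ∑ i, (ω.1 (x, i) + ω.1 (x - unitv d i, i))

/-- The box `Λ_r = [-r,r]^d ∩ ℤ^d`. -/
def box (d : ℕ) (r : ℝ) : Finset (Vert d) :=
  Fintype.piFinset fun _ : Fin d => Finset.Icc ⌈-r⌉ ⌊r⌋

/-- The nearest neighbours of `x` in `ℤ^d`. -/
def nbrs (d : ℕ) (x : Vert d) : Finset (Vert d) :=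
  (Finset.univ.image fun i => x + unitv d i) ∪ (Finset.univ.image fun i => x - unitv d i)

/-- The set `E(Λ)` of edges incident with at least one vertex of `Λ`
(one index per unordered edge). -/
def edgesIn (d : ℕ) (Λ : Finset (Vert d)) : Finset (EdgeIx d) :=
  Λ.biUnion fun x =>
    (Finset.univ.image fun i => (x, i)) ∪ (Finset.univ.image fun i => (x - unitv d i, i))

/-- Bounded functions on `Ω`. -/
def IsBdd (d : ℕ) (f : EnvSp d → ℝ) : Prop := ∃ M, ∀ ω, |f ω| ≤ M

/-- Local functions: `f` depends only on the coordinates in some finite set `B` of edges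
and, viewed as a function of those coordinates, has compact support in `(0,∞)^B`. -/
def IsLocalFn (d : ℕ) (f : EnvSp d → ℝ) : Prop :=
  ∃ B : Finset (EdgeIx d),
    (∀ ω₁ ω₂ : EnvSp d, (∀ e ∈ B, ω₁.1 e = ω₂.1 e) → f ω₁ = f ω₂) ∧
    ∃ a b : ℝ, 0 < a ∧ ∀ ω : EnvSp d, (∃ e ∈ B, ω.1 e < a ∨ b < ω.1 e) → f ω = 0

/-- `ℓ_ω(f) = L`, i.e. the block averages of the translates of `f` converge to `L`. -/
def avgTo (d : ℕ) (ω : EnvSp d) (f : EnvSp d → ℝ) (L : ℝ) : Prop :=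
  Tendsto (fun n : ℕ => (∑ x ∈ box d (n : ℝ), f (shift d x ω)) / ((box d (n : ℝ)).card : ℝ))
    atTop (𝓝 L)

/-- `ω` is averaging: `ℓ_ω(f)` exists for every continuous local `f`. -/
def Averaging (d : ℕ) (ω : EnvSp d) : Prop :=
  ∀ f : EnvSp d → ℝ, Continuous f → IsLocalFn d f → ∃ L, avgTo d ω f L

/-- `ω` is tempered, i.e. `ω ∈ Ω'`. -/
def Tempered (d : ℕ) (ω : EnvSp d) : Prop :=
  Tendsto (fun ε : ℝ =>
      limsup (fun n : ℕ =>
        (∑ e ∈ edgesIn d (box d (n : ℝ)),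
            (if ε ≤ ω.1 e ∧ ω.1 e ≤ ε⁻¹ then (0:ℝ) else 1)) / (n : ℝ) ^ d) atTop)
    (𝓝[>] 0) (𝓝 0)

/-- `P` is the measure `ℙ_ω` associated with an averaging tempered `ω`:
the unique probability measure whose expectation of every bounded continuous function
is the corresponding block-average limit `ℓ_ω(f)`. -/
def IsEnvLaw (d : ℕ) (ω : EnvSp d) (P : Measure (EnvSp d)) : Prop :=
  IsProbabilityMeasure P ∧
    ∀ f : EnvSp d → ℝ, Continuous f → IsBdd d f → avgTo d ω f (∫ ω', f ω' ∂P)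

/-- Ergodicity of a measure on `Ω` with respect to the translations of `ℤ^d`. -/
def ErgodicEnv (d : ℕ) (P : Measure (EnvSp d)) : Prop :=
  ∀ A : Set (EnvSp d), MeasurableSet A → (∀ x : Vert d, shift d x ⁻¹' A = A) →
    P A = 0 ∨ P A = 1

/-- `ω ∈ Ω⋆`: tempered, averaging, and the associated measure `ℙ_ω` is ergodic. -/
def InOmegaStar (d : ℕ) (ω : EnvSp d) : Prop :=
  Tempered d ω ∧ Averaging d ω ∧
    ∀ P : Measure (EnvSp d), IsEnvLaw d ω P → ErgodicEnv d P

/-- `ω ∈ Ω_{p,q}`. -/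
def InOmegaPQ (d : ℕ) (p q : ℝ) (ω : EnvSp d) : Prop :=
  (∃ C : ℝ, ∀ n : ℕ, 1 ≤ n →
      (∑ e ∈ edgesIn d (box d (n : ℝ)), ω.1 e ^ p) / (n : ℝ) ^ d ≤ C) ∧
  (∃ C : ℝ, ∀ n : ℕ, 1 ≤ n →
      (∑ e ∈ edgesIn d (box d (n : ℝ)), ω.1 e ^ (-q)) / (n : ℝ) ^ d ≤ C)

/-- The path space of the discrete-time walk. -/
abbrev Path (d : ℕ) := ℕ → Vert d

/-- One-step transition probabilities `𝖯_ω(x,y) = c_ω(x,y)/π_ω(x)`. -/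
def transP (d : ℕ) (ω : EnvSp d) (x y : Vert d) : ℝ := cnd d ω x y / piOf d ω x

/-- `μ` is the law `P_ω^{x₀}` of the random walk among the conductances `ω`
started at `x₀`: a probability measure on the path space with the prescribed
finite-dimensional (cylinder) probabilities. -/
def IsWalkLaw (d : ℕ) (ω : EnvSp d) (x₀ : Vert d) (μ : Measure (Path d)) : Prop :=
  IsProbabilityMeasure μ ∧
    ∀ (n : ℕ) (γ : ℕ → Vert d),
      μ {w | ∀ k ≤ n, w k = γ k} =
        (if γ 0 = x₀ then 1 else 0) *
          ∏ k ∈ Finset.range n, ENNReal.ofReal (transP d ω (γ k) (γ (k+1)))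

/-- `n`-step transition probabilities of the discrete-time walk. -/
def stepP (d : ℕ) (ω : EnvSp d) : ℕ → Vert d → Vert d → ℝ
  | 0, x, y => if x = y then 1 else 0
  | n+1, x, y => ∑ z ∈ nbrs d x, transP d ω x z * stepP d ω n z y

/-- `P_ω^x(Y_t = y)` for the constant-speed continuous-time walk `Y_t = X_{N(t)}`,
where `N` is an independent rate-1 Poisson process. -/
def ctP (d : ℕ) (ω : EnvSp d) (t : ℝ) (x y : Vert d) : ℝ :=
  ∑' k : ℕ, Real.exp (-t) * t ^ k / (Nat.factorial k : ℝ) * stepP d ω k x y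

/-- The `ℓ¹`-norm of a vertex of `ℤ^d`. -/
def l1 (d : ℕ) (x : Vert d) : ℝ := ∑ i, |(x i : ℝ)|

/-- A vertex of `ℤ^d` regarded as a point of `ℝ^d`. -/
def ivert (d : ℕ) (x : Vert d) : Fin d → ℝ := fun i => (x i : ℝ)

/-- The linearly interpolated diffusively rescaled walk `B^{(n)}`. -/
def BnProc (d : ℕ) (n : ℕ) (w : Path d) (t : ℝ) : Fin d → ℝ :=
  (Real.sqrt n)⁻¹ •
    (ivert d (w ⌊t * n⌋₊) +
      (t * n - (⌊t * n⌋₊ : ℝ)) • (ivert d (w (⌊t * n⌋₊ + 1)) - ivert d (w ⌊t * n⌋₊)))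


/-- The measure `ℚ_ω` obtained from `ℙ_ω` by tilting with `π(0)`. -/
def Qmeas (d : ℕ) (P : Measure (EnvSp d)) : Measure (EnvSp d) :=
  P.withDensity fun ω' => ENNReal.ofReal (piOf d ω' 0 / ∫ ω'', piOf d ω'' 0 ∂P)

/-- The inner product `⟨f,g⟩_{L²(πμ)}`. -/
def innerP (d : ℕ) (P : Measure (EnvSp d)) (f g : EnvSp d → ℝ) : ℝ :=
  ∫ ω', f ω' * g ω' * piOf d ω' 0 ∂P

/-- The Dirichlet pairing `⟨h, (−L)h⟩_{L²(πμ)}`. -/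
def quadL (d : ℕ) (P : Measure (EnvSp d)) (h : EnvSp d → ℝ) : ℝ :=
  ∫ ω', (∑ z ∈ nbrs d 0, cnd d ω' 0 z * (h ω' - h (shift d z ω'))) * h ω' ∂P

/-- The inner product of `L²(ν)`. -/
def innerQ (d : ℕ) (ν : Measure (EnvSp d)) (f g : EnvSp d → ℝ) : ℝ :=
  ∫ ω', f ω' * g ω' ∂ν

/-- The Dirichlet pairing `⟨h, (−L)h⟩_{L²(ν)}`. -/
def quadQ (d : ℕ) (ν : Measure (EnvSp d)) (h : EnvSp d → ℝ) : ℝ :=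
  ∫ ω', ((piOf d ω' 0)⁻¹ *
      ∑ z ∈ nbrs d 0, cnd d ω' 0 z * (h ω' - h (shift d z ω'))) * h ω' ∂ν

/-- The set whose supremum is the variational characterization
`⟨f,(−L)⁻¹f⟩_{L²(ν)} = sup_h [2⟨h,f⟩ − ⟨h,(−L)h⟩]` (over bounded continuous `h`);
`⟨f,(−L)⁻¹f⟩_{L²(ν)} < ∞` means this set is bounded above. -/
def invPairSet (d : ℕ) (ν : Measure (EnvSp d)) (f : EnvSp d → ℝ) : Set ℝ :=
  {r | ∃ h : EnvSp d → ℝ, Continuous h ∧ IsBdd d h ∧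
        r = 2 * innerQ d ν h f - quadQ d ν h}

/-- The function `f(ω) = π_ω(0)⁻¹ ∇⋆(c v)(ω)` built from a vector field `v`. -/
def fDiv (d : ℕ) (v : EnvSp d → Fin d → ℝ) (ω : EnvSp d) : ℝ :=
  (piOf d ω 0)⁻¹ *
    ∑ i, (cnd d ω 0 (unitv d i) * v ω i -
          cnd d ω (-(unitv d i)) 0 * v (shift d (-(unitv d i)) ω) i)

/-- The inner product of `ℓ²(Λ,π_ω)`. -/
def innerF (d : ℕ) (ω : EnvSp d) (Λ : Finset (Vert d)) (f g : Vert d → ℝ) : ℝ :=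
  ∑ x ∈ Λ, f x * g x * piOf d ω x

/-- The pairing `⟨h, (−𝖫_ω)h⟩_{ℓ²(Λ,π_ω)}` for `h` vanishing outside `Λ`. -/
def quadF (d : ℕ) (ω : EnvSp d) (Λ : Finset (Vert d)) (h : Vert d → ℝ) : ℝ :=
  ∑ x ∈ Λ, (∑ z ∈ nbrs d x, cnd d ω x z * (h x - h z)) * h x

/-- `⟨f, (−𝖫_ω)⁻¹_Λ f⟩_{ℓ²(Λ,π_ω)}` via its variational characterization
`sup_h [2⟨h,f⟩ − ⟨h,(−𝖫_ω)h⟩]` over `h ∈ ℓ²(Λ,π_ω)`. -/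
def invPairF (d : ℕ) (ω : EnvSp d) (Λ : Finset (Vert d)) (f : Vert d → ℝ) : ℝ :=
  sSup {r | ∃ h : Vert d → ℝ, (∀ x ∉ Λ, h x = 0) ∧
      r = 2 * innerF d ω Λ h f - quadF d ω Λ h}

/-- The antisymmetric edge function `v∘τ(ω)`: the value assigned to the
edge `(x, x+e_i)` is `v_i(τ_x(ω))`. -/
def efield (d : ℕ) (v : EnvSp d → Fin d → ℝ) (ω : EnvSp d) : Vert d → Fin d → ℝ :=
  fun x i => v (shift d x ω) i

/-- The discrete gradient `∇h` of `h : ℤ^d → ℝ` as an edge function. -/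
def dgradE (d : ℕ) (h : Vert d → ℝ) : Vert d → Fin d → ℝ :=
  fun x i => h (x + unitv d i) - h x

/-- The inner product `⟨u,w⟩_{ℓ²(E(Λ), c_ω)}` of (antisymmetric) edge functions;
each unordered edge is counted once, which agrees with the paper's sum over
ordered edges carrying the factor ½. -/
def einner (d : ℕ) (ω : EnvSp d) (Λ : Finset (Vert d)) (u w : Vert d → Fin d → ℝ) : ℝ :=
  ∑ e ∈ edgesIn d Λ, u e.1 e.2 * w e.1 e.2 * ω.1 e

/-- The Dirichlet energy `𝓔_Λ^ω(v)`. -/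
def direnergy (d : ℕ) (ω : EnvSp d) (Λ : Finset (Vert d)) (v : EnvSp d → Fin d → ℝ) : ℝ :=
  sInf {r | ∃ h : Vert d → ℝ, (∀ x ∉ Λ, h x = 0) ∧
      r = einner d ω Λ (fun x i => efield d v ω x i - dgradE d h x i)
            (fun x i => efield d v ω x i - dgradE d h x i)}

/-- The gradient `∇h` of a function on `Ω`. -/
def gradOmega (d : ℕ) (h : EnvSp d → ℝ) : EnvSp d → Fin d → ℝ :=
  fun ω i => h (shift d (unitv d i) ω) - h ω

/-- The inner product `⟨u, c w⟩_{L²(P,ℝ^d)}`. -/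
def cinnerP (d : ℕ) (P : Measure (EnvSp d)) (u w : EnvSp d → Fin d → ℝ) : ℝ :=
  ∑ i, ∫ ω', cnd d ω' 0 (unitv d i) * u ω' i * w ω' i ∂P

/-- Bounded vector fields on `Ω`. -/
def IsBddV (d : ℕ) (v : EnvSp d → Fin d → ℝ) : Prop := ∃ M, ∀ ω i, |v ω i| ≤ M

/-- The space `𝒱 = (ℝ^d)^{ℤ^d}` of vector fields on `ℤ^d`. -/
abbrev VS (d : ℕ) := Vert d → Fin d → ℝ

/-- The empirical measures `μ_r^{ω,v}` built from the minimizers `h_r` of the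
finite-volume Dirichlet energies. -/
def muR (d : ℕ) (ω : EnvSp d) (hr : ℕ → Vert d → ℝ) (r : ℕ) :
    Measure (EnvSp d × VS d) :=
  (((box d ((r : ℝ) + Real.sqrt r)).card : ℝ≥0∞) *
      ((box d (Real.sqrt r)).card : ℝ≥0∞))⁻¹ •
    ∑ z ∈ box d (Real.sqrt r), ∑ x ∈ box d ((r : ℝ) + Real.sqrt r),
      Measure.dirac (shift d (x + z) ω, fun y => dgradE d (hr r) (x + z + y))

/-- The localized conductances `c_ω^R`. -/
def cR (d : ℕ) (ω : EnvSp d) (R : ℝ) (e : EdgeIx d) : ℝ :=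
  if e ∈ edgesIn d (box d (2 * R)) then ω.1 e else 1

/-- The localized measure `π_ω^R`. -/
def piRloc (d : ℕ) (ω : EnvSp d) (R : ℝ) (x : Vert d) : ℝ :=
  if x ∈ box d (2 * R) then piOf d ω x
  else if x ∈ box d (4 * R) then 1 + piOf d ω x else 1

/-- The localized Dirichlet form `D_ω^R(f,f)` (each unordered edge counted once). -/
def DR (d : ℕ) (ω : EnvSp d) (R : ℝ) (f : Vert d → ℝ) : ℝ≥0∞ :=
  ∑' e : EdgeIx d, ENNReal.ofReal (cR d ω R e * (f (e.1 + unitv d e.2) - f e.1) ^ 2)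

/-- The norm `‖f‖_{ℓ^s(μ)}`. -/
def lpN (d : ℕ) (μw : Vert d → ℝ) (s : ℝ) (f : Vert d → ℝ) : ℝ≥0∞ :=
  (∑' x : Vert d, ENNReal.ofReal (|f x| ^ s * μw x)) ^ (1 / s)

/-- The exponent `ε = 2(2/d − 1/p − 1/q)((d−2)/d + 1/q)⁻¹`. -/
def epsPQ (d : ℕ) (p q : ℝ) : ℝ :=
  2 * (2 / (d : ℝ) - 1 / p - 1 / q) / (((d : ℝ) - 2) / (d : ℝ) + 1 / q)

/-- Jump rates of the localized constant-speed chain `Y^R`: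
rate `c_ω^R(x,y)/π_ω^R(x)` from `x` to `y`. -/
def rateR (d : ℕ) (ω : EnvSp d) (R : ℝ) (x y : Vert d) : ℝ :=
  (∑ i, ((if y = x + unitv d i then cR d ω R (x, i) else 0) +
         (if x = y + unitv d i then cR d ω R (y, i) else 0))) / piRloc d ω R x

/-- The generator matrix of `Y^R`. -/
def qmatR (d : ℕ) (ω : EnvSp d) (R : ℝ) (x y : Vert d) : ℝ :=
  if x = y then -(∑ z ∈ nbrs d x, rateR d ω R x z) else rateR d ω R x y

/-- Iterates of the generator matrix of `Y^R`. -/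
def qiter (d : ℕ) (ω : EnvSp d) (R : ℝ) : ℕ → Vert d → Vert d → ℝ
  | 0, x, y => if x = y then 1 else 0
  | n+1, x, y => ∑ z ∈ insert x (nbrs d x), qmatR d ω R x z * qiter d ω R n z y

/-- The heat kernel `P_ω^x(Y_t^R = y) = (e^{tQ})(x,y)` of the localized chain `Y^R`. -/
def hkR (d : ℕ) (ω : EnvSp d) (R : ℝ) (t : ℝ) (x y : Vert d) : ℝ :=
  ∑' k : ℕ, t ^ k / (Nat.factorial k : ℝ) * qiter d ω R k x y

lemma card_box (d n : ℕ) : (box d (n : ℝ)).card = (2 * n + 1) ^ d := by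
  have h1 : ⌈-(n : ℝ)⌉ = -(n : ℤ) := by rw [Int.ceil_neg, Int.floor_natCast]
  have h2 : ⌊(n : ℝ)⌋ = (n : ℤ) := Int.floor_natCast n
  simp only [box, Fintype.card_piFinset, h1, h2, Int.card_Icc, Finset.prod_const,
    Finset.card_univ, Fintype.card_fin]
  congr 1
  omega

lemma pow_le_card_box (d n : ℕ) : (n : ℝ) ^ d ≤ ((box d (n : ℝ)).card : ℝ) := by
  rw [card_box]
  push_cast
  gcongr
  linarith [Nat.cast_nonneg (α := ℝ) n]

/-- The block average of `f` over `Λ_n`. -/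
def blockAvg (d : ℕ) (ω : EnvSp d) (f : EnvSp d → ℝ) (n : ℕ) : ℝ :=
  (∑ x ∈ box d (n : ℝ), f (shift d x ω)) / ((box d (n : ℝ)).card : ℝ)

lemma card_box_pos (d n : ℕ) : (0 : ℝ) < ((box d (n : ℝ)).card : ℝ) := by
  rw [card_box]
  positivity

lemma blockAvg_mono {d : ℕ} {ω : EnvSp d} {f g : EnvSp d → ℝ} (h : ∀ ω', f ω' ≤ g ω') (n : ℕ) :
    blockAvg d ω f n ≤ blockAvg d ω g n :=
  div_le_div_of_nonneg_right (Finset.sum_le_sum fun _ _ => h _) (card_box_pos d n).le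

lemma blockAvg_add_const_mul (d : ℕ) (ω : EnvSp d) (f : EnvSp d → ℝ) (a b : ℝ) (n : ℕ) :
    blockAvg d ω (fun ω' => a + b * f ω') n = a + b * blockAvg d ω f n := by
  have := (card_box_pos d n).ne'
  simp only [blockAvg, Finset.sum_add_distrib, Finset.sum_const, nsmul_eq_mul, ← Finset.mul_sum]
  field_simp

lemma abs_blockAvg_sub_le (d : ℕ) (ω : EnvSp d) (f g : EnvSp d → ℝ) (n : ℕ) :
    |blockAvg d ω f n - blockAvg d ω g n| ≤ blockAvg d ω (fun ω' => |f ω' - g ω'|) n := by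
  simp only [blockAvg]
  rw [← sub_div, ← Finset.sum_sub_distrib, abs_div, abs_of_pos (card_box_pos d n)]
  exact div_le_div_of_nonneg_right (Finset.abs_sum_le_sum_abs _ _) (card_box_pos d n).le

lemma blockAvg_le_of_sum_div_pow_le {d : ℕ} {ω : EnvSp d} {g : EnvSp d → ℝ} {C : ℝ} {n : ℕ}
    (hn : 1 ≤ n) (hg : ∀ ω', 0 ≤ g ω')
    (h : (∑ x ∈ box d (n : ℝ), g (shift d x ω)) / (n : ℝ) ^ d ≤ C) :
    blockAvg d ω g n ≤ C := by
  refine le_trans ?_ h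
  have : (0 : ℝ) < n := by exact_mod_cast hn
  exact div_le_div_of_nonneg_left (Finset.sum_nonneg fun _ _ => hg _) (by positivity)
    (pow_le_card_box d n)

/-- Truncation of a real number to `[-M, M]`. -/
def truncate (M t : ℝ) : ℝ := max (-M) (min t M)

lemma continuous_truncate (M : ℝ) : Continuous (truncate M) := by
  unfold truncate
  fun_prop

lemma abs_truncate_le {M : ℝ} (hM : 0 ≤ M) (t : ℝ) : |truncate M t| ≤ M :=
  abs_le.2 ⟨le_max_left _ _, max_le (by linarith) (min_le_right _ _)⟩

lemma truncate_eq_self {M t : ℝ} (h : |t| ≤ M) : truncate M t = t := by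
  obtain ⟨h1, h2⟩ := abs_le.1 h
  rw [truncate, min_eq_left h2, max_eq_right h1]

lemma abs_truncate_le_abs {M : ℝ} (hM : 0 ≤ M) (t : ℝ) : |truncate M t| ≤ |t| := by
  rcases le_total |t| M with h | h
  · rw [truncate_eq_self h]
  · exact (abs_truncate_le hM t).trans h

lemma abs_sub_truncate_le_abs {M : ℝ} (hM : 0 ≤ M) (t : ℝ) : |t - truncate M t| ≤ |t| := by
  unfold truncate
  rcases le_total t M with h | h <;> rcases le_total (-M) t with h' | h' <;>
    rcases le_total 0 t with h'' | h'' <;>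
    simp only [h, h', min_eq_left, min_eq_right, max_eq_left, max_eq_right,
      max_eq_right (show -M ≤ M by linarith), abs_of_nonneg, abs_of_nonpos, h''] <;>
    rw [abs_le] <;> constructor <;> linarith

lemma le_rpow_mul_rpow {α M s t : ℝ} (hα : 1 < α) (hM : 0 < M) (hMt : M ≤ t) (hts : t ≤ s) :
    t ≤ M ^ (1 - α) * s ^ α := by
  have ht : 0 < t := hM.trans_le hMt
  calc t = t ^ (1 - α) * t ^ α := by rw [← Real.rpow_add ht]; simp
    _ ≤ M ^ (1 - α) * s ^ α :=
      mul_le_mul (Real.rpow_le_rpow_of_nonpos hM hMt (by linarith))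
        (Real.rpow_le_rpow ht.le hts (by linarith)) (by positivity) (by positivity)

lemma abs_sub_truncate_le {α M s t : ℝ} (hα : 1 < α) (hM : 0 < M) (hts : |t| ≤ s) :
    |t - truncate M t| ≤ M ^ (1 - α) * s ^ α := by
  have hs : 0 ≤ s := (abs_nonneg t).trans hts
  rcases le_total |t| M with h | h
  · rw [truncate_eq_self h, sub_self, abs_zero]
    positivity
  · exact (abs_sub_truncate_le_abs hM.le t).trans (le_rpow_mul_rpow hα hM h hts)

lemma abs_le_one_add_rpow {α s t : ℝ} (hα : 1 < α) (hts : |t| ≤ s) :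
    |t| ≤ 1 + 1 * s ^ α := by
  have hs : 0 ≤ s ^ α := Real.rpow_nonneg ((abs_nonneg t).trans hts) α
  rcases le_total |t| 1 with h | h
  · linarith
  · have := le_rpow_mul_rpow hα one_pos h hts
    rw [Real.one_rpow] at this
    linarith

lemma tendsto_truncate (t : ℝ) : Tendsto (fun k : ℕ => truncate k t) atTop (𝓝 t) := by
  refine tendsto_const_nhds.congr' ?_
  filter_upwards [eventually_ge_atTop ⌈|t|⌉₊] with k hk
  exact (truncate_eq_self (Nat.ceil_le.1 hk)).symm

lemma integrable_of_integral_abs_truncate_le {X : Type*} [MeasurableSpace X] {μ : Measure X}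
    [IsFiniteMeasure μ] {f : X → ℝ} (hf : Measurable f) {K : ℝ}
    (hK : ∀ k : ℕ, ∫ x, |truncate k (f x)| ∂μ ≤ K) : Integrable f μ := by
  refine ⟨hf.aestronglyMeasurable, ?_⟩
  have hm : ∀ k : ℕ, Measurable fun x => truncate k (f x) := fun k =>
    (continuous_truncate k).measurable.comp hf
  have hint : ∀ k : ℕ, Integrable (fun x => truncate k (f x)) μ := fun k =>
    Integrable.of_bound (hm k).aestronglyMeasurable k
      (ae_of_all _ fun x => abs_truncate_le k.cast_nonneg _)
  have hlim : ∀ x, liminf (fun k : ℕ => ‖truncate k (f x)‖ₑ) atTop = ‖f x‖ₑ := fun x =>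
    ((tendsto_truncate (f x)).enorm).liminf_eq
  calc ∫⁻ x, ‖f x‖ₑ ∂μ = ∫⁻ x, liminf (fun k : ℕ => ‖truncate k (f x)‖ₑ) atTop ∂μ := by
        simp only [hlim]
    _ ≤ liminf (fun k : ℕ => ∫⁻ x, ‖truncate k (f x)‖ₑ ∂μ) atTop :=
        lintegral_liminf_le fun k => (hm k).enorm
    _ ≤ liminf (fun _ : ℕ => ENNReal.ofReal K) atTop := by
        refine liminf_le_liminf (Eventually.of_forall fun k => ?_)
        rw [← ofReal_integral_norm_eq_lintegral_enorm (hint k)]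
        exact ENNReal.ofReal_le_ofReal (hK k)
    _ < ∞ := by simp

/-- Lemma 3.1. -/
theorem statement1 (d : ℕ) (hd : 1 ≤ d) (ω : EnvSp d)
    (hA : Averaging d ω) (hT : Tempered d ω)
    (P : Measure (EnvSp d)) (hP : IsEnvLaw d ω P)
    (f h : EnvSp d → ℝ) (hf : Continuous f) (hh : ∀ ω', 0 ≤ h ω')
    (hdom : ∀ ω', |f ω'| ≤ h ω') (α : ℝ) (hα : 1 < α)
    (hsum : ∃ C : ℝ, ∀ n : ℕ, 1 ≤ n →
        (∑ x ∈ box d (n : ℝ), h (shift d x ω) ^ α) / (n : ℝ) ^ d ≤ C) :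
    Integrable f P ∧ avgTo d ω f (∫ ω', f ω' ∂P) := by
  obtain ⟨C, hC⟩ := hsum
  obtain ⟨hprob, hlaw⟩ := hP
  have hpow : ∀ ω', 0 ≤ h ω' ^ α := fun ω' => Real.rpow_nonneg (hh ω') α
  have hCavg : ∀ n : ℕ, 1 ≤ n → blockAvg d ω (fun ω' => h ω' ^ α) n ≤ C := fun n hn =>
    blockAvg_le_of_sum_div_pow_le hn hpow (hC n hn)
  have hcont : ∀ M : ℝ, Continuous fun ω' => truncate M (f ω') := fun M =>
    (continuous_truncate M).comp hf
  have hint : Integrable f P := by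
    refine integrable_of_integral_abs_truncate_le hf.measurable (K := 1 + 1 * C) fun k => ?_
    refine le_of_tendsto (hlaw (fun ω' => |truncate k (f ω')|) (hcont k).abs
      ⟨k, fun ω' => by simpa using abs_truncate_le k.cast_nonneg (f ω')⟩) ?_
    filter_upwards [eventually_ge_atTop 1] with n hn
    calc blockAvg d ω (fun ω' => |truncate k (f ω')|) n
        ≤ blockAvg d ω (fun ω' => 1 + 1 * h ω' ^ α) n :=
          blockAvg_mono (fun ω' => (abs_truncate_le_abs k.cast_nonneg _).trans
            (abs_le_one_add_rpow hα (hdom ω'))) n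
      _ = 1 + 1 * blockAvg d ω (fun ω' => h ω' ^ α) n := blockAvg_add_const_mul ..
      _ ≤ 1 + 1 * C := by linarith [hCavg n hn]
  refine ⟨hint, ?_⟩
  have hI : Tendsto (fun k : ℕ => ∫ ω', truncate k (f ω') ∂P) atTop (𝓝 (∫ ω', f ω' ∂P)) :=
    tendsto_integral_of_dominated_convergence (fun ω' => |f ω'|)
      (fun k => (hcont k).measurable.aestronglyMeasurable) hint.abs
      (fun k => ae_of_all _ fun ω' => abs_truncate_le_abs k.cast_nonneg _)
      (ae_of_all _ fun ω' => tendsto_truncate _)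
  have hR : Tendsto (fun k : ℕ => (k : ℝ) ^ (1 - α) * C) atTop (𝓝 0) := by
    have := ((tendsto_rpow_neg_atTop (show 0 < α - 1 by linarith)).comp
      tendsto_natCast_atTop_atTop).mul_const C
    simpa [Function.comp_def] using this
  change Tendsto (blockAvg d ω f) atTop (𝓝 (∫ ω', f ω' ∂P))
  rw [Metric.tendsto_atTop']
  intro ε hε
  obtain ⟨k, hk1, hkI, hkR⟩ := ((eventually_ge_atTop 1).and
    ((Metric.tendsto_nhds.1 hI (ε / 3) (by positivity)).and
      (hR.eventually (gt_mem_nhds (show 0 < ε / 3 by positivity))))).exists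
  have hk0 : (0 : ℝ) < k := by exact_mod_cast hk1
  have hlim : Tendsto (blockAvg d ω fun ω' => truncate k (f ω')) atTop
      (𝓝 (∫ ω', truncate k (f ω') ∂P)) :=
    hlaw _ (hcont k) ⟨k, fun ω' => abs_truncate_le hk0.le _⟩
  obtain ⟨N, hN⟩ := Metric.tendsto_atTop.1 hlim (ε / 3) (by positivity)
  refine ⟨N + 1, fun n hn => ?_⟩
  have hn1 : 1 ≤ n := by omega
  have hdiff : |blockAvg d ω f n - blockAvg d ω (fun ω' => truncate k (f ω')) n|
      ≤ (k : ℝ) ^ (1 - α) * C :=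
    calc _ ≤ blockAvg d ω (fun ω' => |f ω' - truncate k (f ω')|) n := abs_blockAvg_sub_le ..
      _ ≤ blockAvg d ω (fun ω' => 0 + (k : ℝ) ^ (1 - α) * h ω' ^ α) n :=
          blockAvg_mono (fun ω' => by
            simpa using abs_sub_truncate_le hα hk0 (hdom ω')) n
      _ = 0 + (k : ℝ) ^ (1 - α) * blockAvg d ω (fun ω' => h ω' ^ α) n :=
          blockAvg_add_const_mul ..
      _ ≤ (k : ℝ) ^ (1 - α) * C := by
          rw [zero_add]
          exact mul_le_mul_of_nonneg_left (hCavg n hn1) (by positivity)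
  have hNn := hN n (by omega)
  rw [← Real.dist_eq] at hdiff
  linarith [dist_triangle4 (blockAvg d ω f n) (blockAvg d ω (fun ω' => truncate k (f ω')) n)
    (∫ ω', truncate k (f ω') ∂P) (∫ ω', f ω' ∂P)]


end DetCond
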